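/- Assume H > (6/(3+ν))·H_{f,3}(ν) (so that τ_H > 1 and μ_H > 0), that f has a global minimizer x*, that x ∈ F(x₀) := {z : f(z) ≤ f(x₀)} with sup_{y∈F(x₀)} ‖y − x*‖ ≤ R₀ and R₀ ≥ 1, and that Ω := Ω_{x,3,H}^{(ν)} attains its global minimum on E. Let {y_k} be generated by Algorithm 1 with parameter L₀ > 0, and set M_H = max{2L₀, 4L_H} and N_x = ‖∇²f(x)‖ + 12R₀². Let ε ∈ (0,1) and let T be a nonnegative integer with T + 1 ≥ [log₂(M_H/(M_H − μ_H))]^{-1}. If ‖∇Ω(y_{T+1})‖ > ε, then T·log₂(M_H/(M_H − μ_H)) ≤ C_{x,H} + (3+ν)·log₂(ε^{-1}), where C_{x,H} = log₂(2^{3+ν}·(3+ν)·M_H^{2+ν}·N_x^{5+ν}·μ_H). -/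

import Mathlib

open scoped InnerProductSpace

/-- The Bregman distance `β_d(u, v) = d(v) − d(u) − ⟨∇d(u), v − u⟩`. -/
noncomputable def breg {E : Type*} [NormedAddCommGroup E] [InnerProductSpace ℝ E]
    [CompleteSpace E] (d : E → ℝ) (u v : E) : ℝ :=
  d v - d u - ⟪gradient d u, v - u⟫_ℝ

/-- One successful step of the adaptive Bregman proximal gradient method with coefficient `M`:
`w` is a global minimizer of `z ↦ ⟨∇g(yk), z − yk⟩ + M·β_d(yk, z)` and satisfies the
sufficient-decrease acceptance test. -/
noncomputable def stepOK {E : Type*} [NormedAddCommGroup E] [InnerProductSpace ℝ E]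
    [CompleteSpace E] (g d : E → ℝ) (M : ℝ) (yk w : E) : Prop :=
  (∀ z : E, ⟪gradient g yk, w - yk⟫_ℝ + M * breg d yk w
      ≤ ⟪gradient g yk, z - yk⟫_ℝ + M * breg d yk z) ∧
  g w ≤ g yk + ⟪gradient g yk, w - yk⟫_ℝ + M * breg d yk w

/-- Algorithm A (adaptive Bregman proximal gradient method): `L 0 = L₀` and, for each `k`,
`i k` is the smallest integer `≥ 0` such that the regularized step with coefficient
`2^{i k}·L k` exists and is accepted, `y (k+1)` is that step, and `L (k+1) = 2^{i k − 1}·L k`. -/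
noncomputable def algA {E : Type*} [NormedAddCommGroup E] [InnerProductSpace ℝ E]
    [CompleteSpace E] (g d : E → ℝ) (L0 : ℝ) (y : ℕ → E) (L : ℕ → ℝ) (i : ℕ → ℕ) : Prop :=
  L 0 = L0 ∧ ∀ k : ℕ,
    stepOK g d ((2 : ℝ) ^ i k * L k) (y k) (y (k + 1)) ∧
    (∀ j : ℕ, j < i k → ¬ ∃ w : E, stepOK g d ((2 : ℝ) ^ j * L k) (y k) w) ∧
    L (k + 1) = (2 : ℝ) ^ i k * L k / 2

section
variable {E : Type*} [NormedAddCommGroup E] [NormedSpace ℝ E]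

theorem ContDiff.contDiff_fderiv_fderiv {f : E → ℝ} (hf : ContDiff ℝ 3 f) :
    ContDiff ℝ 1 (fderiv ℝ (fderiv ℝ f)) :=
  (hf.fderiv_right (m := 2) (by norm_num)).fderiv_right (by norm_num)

theorem iteratedFDeriv_three_apply_eq {f : E → ℝ} (hf : ContDiff ℝ 3 f) (x a b c : E) :
    iteratedFDeriv ℝ 3 f x ![a, b, c] = fderiv ℝ (fderiv ℝ (fderiv ℝ f)) x a b c := by
  rw [DifferentiableAt.iteratedFDeriv_succ_apply_left'
    ((hf.differentiable_iteratedFDeriv (m := 2) (by norm_num)) x)]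
  have h : (fun y => iteratedFDeriv ℝ 2 f y (Fin.tail ![a, b, c])) =
      fun y => fderiv ℝ (fderiv ℝ f) y b c := by
    ext y
    rw [iteratedFDeriv_two_apply]
    rfl
  have hd := hf.contDiff_fderiv_fderiv.differentiable (by norm_num) x
  rw [h]
  have := ((hd.hasFDerivAt.clm_apply (hasFDerivAt_const b x)).clm_apply
    (hasFDerivAt_const c x)).fderiv
  rw [this]
  simp

theorem hasDerivAt_comp_line {F : Type*} [NormedAddCommGroup F] [NormedSpace ℝ F] {g : E → F}
    (hg : Differentiable ℝ g) (u w : E) (t : ℝ) :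
    HasDerivAt (fun s : ℝ => g (u + s • w)) (fderiv ℝ g (u + t • w) w) t := by
  have h : HasDerivAt (fun s : ℝ => u + s • w) w t := by
    simpa using ((hasDerivAt_id t).smul_const w).const_add u
  exact (hg _).hasFDerivAt.comp_hasDerivAt t h

theorem fderiv_fderiv_apply_comm {f : E → ℝ} (hf : ContDiff ℝ 3 f) (x a b : E) :
    fderiv ℝ (fderiv ℝ f) x a b = fderiv ℝ (fderiv ℝ f) x b a :=
  hf.contDiffAt.isSymmSndFDerivAt (by simp; norm_num) a b

theorem fderiv_three_apply_comm_left {f : E → ℝ} (hf : ContDiff ℝ 3 f) (x a b c : E) :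
    fderiv ℝ (fderiv ℝ (fderiv ℝ f)) x a b c = fderiv ℝ (fderiv ℝ (fderiv ℝ f)) x b a c := by
  have h : ContDiff ℝ 2 (fderiv ℝ f) := hf.fderiv_right (by norm_num)
  rw [h.contDiffAt.isSymmSndFDerivAt (by simp) a b]

theorem hasDerivAt_fderiv_fderiv_line {f : E → ℝ} (hf : ContDiff ℝ 3 f) (u w b c : E) (t : ℝ) :
    HasDerivAt (fun s : ℝ => fderiv ℝ (fderiv ℝ f) (u + s • w) b c)
      (fderiv ℝ (fderiv ℝ (fderiv ℝ f)) (u + t • w) w b c) t := by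
  have hd := hf.contDiff_fderiv_fderiv.differentiable (by norm_num)
  have := ((hasDerivAt_comp_line hd u w t).clm_apply (hasDerivAt_const t b)).clm_apply
    (hasDerivAt_const t c)
  simpa using this

theorem fderiv_three_apply_comm_right {f : E → ℝ} (hf : ContDiff ℝ 3 f) (x a b c : E) :
    fderiv ℝ (fderiv ℝ (fderiv ℝ f)) x a b c = fderiv ℝ (fderiv ℝ (fderiv ℝ f)) x a c b := by
  have h₁ := hasDerivAt_fderiv_fderiv_line hf x a b c 0
  have h₂ := hasDerivAt_fderiv_fderiv_line hf x a c b 0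
  simp only [fderiv_fderiv_apply_comm hf _ c b] at h₂
  simpa using h₁.unique h₂

theorem hasDerivAt_fderiv_line {f : E → ℝ} (hf : ContDiff ℝ 3 f) (u w b : E) (t : ℝ) :
    HasDerivAt (fun s : ℝ => fderiv ℝ f (u + s • w) b)
      (fderiv ℝ (fderiv ℝ f) (u + t • w) w b) t := by
  have hd : Differentiable ℝ (fderiv ℝ f) :=
    (hf.fderiv_right (m := 2) (by norm_num)).differentiable (by norm_num)
  have := (hasDerivAt_comp_line hd u w t).clm_apply (hasDerivAt_const t b)
  simpa using this

theorem ConvexOn.fderiv_fderiv_nonneg {f : E → ℝ} (hf : ContDiff ℝ 3 f)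
    (hconv : ConvexOn ℝ Set.univ f) (u w : E) : 0 ≤ fderiv ℝ (fderiv ℝ f) u w w := by
  have hd : Differentiable ℝ f := hf.differentiable (by norm_num)
  have hc : ConvexOn ℝ Set.univ (fun s : ℝ => f (u + s • w)) := by
    have := hconv.comp_affineMap (AffineMap.lineMap u (u + w) : ℝ →ᵃ[ℝ] E)
    simpa [Function.comp_def, AffineMap.lineMap_apply, add_comm] using this
  have hm := hc.monotoneOn_deriv fun t _ => (hasDerivAt_comp_line hd u w t).differentiableAt
  have he : deriv (fun s : ℝ => f (u + s • w)) = fun s => fderiv ℝ f (u + s • w) w := by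
    ext t
    exact (hasDerivAt_comp_line hd u w t).deriv
  rw [he, monotoneOn_univ] at hm
  simpa using (hasDerivAt_fderiv_line hf u w w 0).nonneg_of_monotone hm

/-- Taylor estimate for the Hessian under a Hölder third derivative. -/
theorem fderiv_fderiv_le_of_holder {f : E → ℝ} (hf : ContDiff ℝ 3 f) {ν Hf : ℝ} (hν : 0 ≤ ν)
    (hHf : 0 ≤ Hf)
    (hHolder : ∀ x y : E,
      ‖iteratedFDeriv ℝ 3 f x - iteratedFDeriv ℝ 3 f y‖ ≤ Hf * ‖x - y‖ ^ ν) (x h w : E) :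
    fderiv ℝ (fderiv ℝ f) (x + h) w w ≤ fderiv ℝ (fderiv ℝ f) x w w +
      fderiv ℝ (fderiv ℝ (fderiv ℝ f)) x h w w + Hf * ‖h‖ ^ (1 + ν) * ‖w‖ ^ 2 := by
  have hder := hasDerivAt_fderiv_fderiv_line hf x h w w
  obtain ⟨c, hc, hceq⟩ := exists_hasDerivAt_eq_slope _ _ (zero_lt_one' ℝ)
    (fun t _ => (hder t).continuousAt.continuousWithinAt) fun t _ => hder t
  simp only [one_smul, zero_smul, add_zero, sub_zero, div_one] at hceq
  have hb := (iteratedFDeriv ℝ 3 f (x + c • h) - iteratedFDeriv ℝ 3 f x).le_opNorm ![h, w, w]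
  have hn : ∏ i, ‖(![h, w, w] : Fin 3 → E) i‖ = ‖h‖ * ‖w‖ ^ 2 := by
    simp [Fin.prod_univ_three]; ring
  rw [hn, sub_apply, iteratedFDeriv_three_apply_eq hf,
    iteratedFDeriv_three_apply_eq hf] at hb
  have hH := hHolder (x + c • h) x
  have hle : ‖x + c • h - x‖ ^ ν ≤ ‖h‖ ^ ν := by
    apply Real.rpow_le_rpow (norm_nonneg _) _ hν
    rw [add_sub_cancel_left, norm_smul, Real.norm_of_nonneg hc.1.le]
    exact mul_le_of_le_one_left (norm_nonneg _) hc.2.le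
  have hp : ‖h‖ ^ (1 + ν) = ‖h‖ * ‖h‖ ^ ν := by
    rw [Real.rpow_add' (norm_nonneg _) (by positivity), Real.rpow_one]
  have := calc
    fderiv ℝ (fderiv ℝ (fderiv ℝ f)) (x + c • h) h w w - fderiv ℝ (fderiv ℝ (fderiv ℝ f)) x h w w
      ≤ _ := le_trans (le_abs_self _) hb
    _ ≤ Hf * ‖h‖ ^ ν * (‖h‖ * ‖w‖ ^ 2) := by
      gcongr
      exact hH.trans (by gcongr)
    _ = Hf * ‖h‖ ^ (1 + ν) * ‖w‖ ^ 2 := by rw [hp]; ring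
  linarith

end

theorem le_of_hasDerivAt_of_second_nonneg {φ φ' φ'' : ℝ → ℝ}
    (h₁ : ∀ t, HasDerivAt φ (φ' t) t) (h₂ : ∀ t, HasDerivAt φ' (φ'' t) t)
    (h : ∀ t ∈ Set.Icc (0 : ℝ) 1, 0 ≤ φ'' t) : φ 0 + φ' 0 ≤ φ 1 := by
  have hm : MonotoneOn φ' (Set.Icc 0 1) :=
    monotoneOn_of_hasDerivWithinAt_nonneg (convex_Icc 0 1)
      (fun t _ => (h₂ t).continuousAt.continuousWithinAt) (fun t _ => (h₂ t).hasDerivWithinAt)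
      fun t ht => h t (interior_subset ht)
  obtain ⟨c, hc, hceq⟩ := exists_hasDerivAt_eq_slope φ φ' (zero_lt_one' ℝ)
    (fun t _ => (h₁ t).continuousAt.continuousWithinAt) fun t _ => h₁ t
  have := hm (by simp) ⟨hc.1.le, hc.2.le⟩ hc.1.le
  rw [hceq] at this
  linarith

section
variable {E : Type*} [NormedAddCommGroup E] [InnerProductSpace ℝ E]

/-- Derivative along a line of the power `‖·‖ ^ p / p`. -/
theorem hasDerivAt_norm_rpow_line {p : ℝ} (hp : 1 < p) (u w : E) (t : ℝ) :
    HasDerivAt (fun s : ℝ => ‖u + s • w‖ ^ p / p)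
      (‖u + t • w‖ ^ (p - 2) * ⟪u + t • w, w⟫_ℝ) t := by
  have h : HasDerivAt (fun s : ℝ => u + s • w) w t := by
    simpa using ((hasDerivAt_id t).smul_const w).const_add u
  have := ((hasFDerivAt_norm_rpow (u + t • w) hp).comp_hasDerivAt t h).div_const p
  convert! this using 1
  have hp0 : p ≠ 0 := by positivity
  simp only [smul_apply, innerSL_apply_apply, smul_eq_mul]
  field_simp

theorem hasDerivAt_mul_of_eq_zero {a b : ℝ → ℝ} {b' t : ℝ} (ha : ContinuousAt a t)
    (hb : HasDerivAt b b' t) (h0 : b t = 0) :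
    HasDerivAt (fun s => a s * b s) (a t * b') t := by
  rw [hasDerivAt_iff_tendsto_slope] at hb ⊢
  have := (ha.tendsto.mono_left nhdsWithin_le_nhds).mul hb
  refine this.congr fun s => ?_
  simp [slope_def_field, h0]
  ring

theorem hasDerivAt_norm_rpow_line_second {q : ℝ} (hq : 0 < q) (u w : E) (t : ℝ) :
    HasDerivAt (fun s : ℝ => ‖u + s • w‖ ^ q * ⟪u + s • w, w⟫_ℝ)
      (‖u + t • w‖ ^ q * ‖w‖ ^ 2 + q * ‖u + t • w‖ ^ (q - 2) * ⟪u + t • w, w⟫_ℝ ^ 2) t := by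
  have h : HasDerivAt (fun s : ℝ => u + s • w) w t := by
    simpa using ((hasDerivAt_id t).smul_const w).const_add u
  have hi : HasDerivAt (fun s : ℝ => ⟪u + s • w, w⟫_ℝ) (‖w‖ ^ 2) t := by
    simpa using h.inner ℝ (hasDerivAt_const t w)
  by_cases h0 : u + t • w = 0
  · have hc : ContinuousAt (fun s : ℝ => ‖u + s • w‖ ^ q) t :=
      h.continuousAt.norm.rpow_const (Or.inr hq.le)
    simpa [h0] using hasDerivAt_mul_of_eq_zero hc hi (by simp [h0])
  · have hn : ‖u + t • w‖ ≠ 0 := norm_ne_zero_iff.mpr h0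
    have hsq : HasDerivAt (fun s : ℝ => (‖u + s • w‖ ^ 2) ^ (q / 2)) _ t :=
      h.norm_sq.rpow_const (Or.inl (pow_ne_zero 2 hn))
    have he : ∀ (r : ℝ) (v : E), (‖v‖ ^ 2) ^ r = ‖v‖ ^ (2 * r) := fun r v => by
      rw [← Real.rpow_natCast, ← Real.rpow_mul (norm_nonneg _)]; norm_num
    simp only [he, show 2 * (q / 2) = q by ring, show 2 * (q / 2 - 1) = q - 2 by ring] at hsq
    convert! hsq.mul hi using 1
    ring

theorem differentiable_norm_sub_rpow {ν : ℝ} (hν : 0 ≤ ν) (x : E) :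
    Differentiable ℝ fun y : E => 1 / (3 + ν) * ‖y - x‖ ^ ((3 : ℝ) + ν) :=
  ((differentiable_norm_rpow (E := E) (by linarith : 1 < (3 : ℝ) + ν)).comp
    (differentiable_id.sub_const x)).const_mul _

theorem rpow_second_le {ν : ℝ} (hν : 0 ≤ ν) (h w : E) :
    ‖h‖ ^ (1 + ν) * ‖w‖ ^ 2 + (1 + ν) * ‖h‖ ^ (1 + ν - 2) * ⟪h, w⟫_ℝ ^ 2 ≤
      (2 + ν) * ‖h‖ ^ (1 + ν) * ‖w‖ ^ 2 := by
  rcases eq_or_ne h 0 with rfl | hh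
  · have : (1 + ν) ≠ 0 := by positivity
    simp [this]
  · have hp : ‖h‖ ^ (1 + ν) = ‖h‖ ^ (1 + ν - 2) * ‖h‖ ^ 2 := by
      rw [← Real.rpow_natCast, ← Real.rpow_add (norm_pos_iff.mpr hh)]
      norm_num
    have hcs : ⟪h, w⟫_ℝ ^ 2 ≤ (‖h‖ * ‖w‖) ^ 2 := by
      rw [← sq_abs]
      gcongr
      exact abs_real_inner_le_norm h w
    have : (1 + ν) * ‖h‖ ^ (1 + ν - 2) * ⟪h, w⟫_ℝ ^ 2 ≤
        (1 + ν) * ‖h‖ ^ (1 + ν - 2) * (‖h‖ * ‖w‖) ^ 2 := by gcongr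
    rw [hp]
    linear_combination this

theorem le_rpow_second {ν : ℝ} (hν : 0 ≤ ν) (h w : E) :
    ‖h‖ ^ (1 + ν) * ‖w‖ ^ 2 ≤
      ‖h‖ ^ (1 + ν) * ‖w‖ ^ 2 + (1 + ν) * ‖h‖ ^ (1 + ν - 2) * ⟪h, w⟫_ℝ ^ 2 := by
  have : 0 ≤ (1 + ν) * ‖h‖ ^ (1 + ν - 2) * ⟪h, w⟫_ℝ ^ 2 := by positivity
  linarith

end

section
variable {E : Type*} [NormedAddCommGroup E] [InnerProductSpace ℝ E] [CompleteSpace E]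

theorem breg_eq_fderiv (g : E → ℝ) (u v : E) :
    breg g u v = g v - g u - fderiv ℝ g u (v - u) := by
  rw [breg, inner_gradient_left]

theorem breg_eq_of_hasDerivAt_line {g : E → ℝ} {u v : E} {d : ℝ} (hg : DifferentiableAt ℝ g u)
    (hd : HasDerivAt (fun s : ℝ => g (u + s • (v - u))) d 0) : breg g u v = g v - g u - d := by
  have h : HasDerivAt (fun s : ℝ => u + s • (v - u)) (v - u) 0 := by
    simpa using ((hasDerivAt_id (0 : ℝ)).smul_const (v - u)).const_add u
  have hg' : HasFDerivAt g (fderiv ℝ g u) (u + (0 : ℝ) • (v - u)) := by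
    simpa using hg.hasFDerivAt
  rw [breg_eq_fderiv, hd.unique (hg'.comp_hasDerivAt 0 h)]

theorem breg_add {g₁ g₂ : E → ℝ} (h₁ : Differentiable ℝ g₁) (h₂ : Differentiable ℝ g₂) (u v : E) :
    breg (fun y => g₁ y + g₂ y) u v = breg g₁ u v + breg g₂ u v := by
  simp only [breg_eq_fderiv, fderiv_fun_add (h₁ u) (h₂ u), add_apply]
  ring

theorem breg_const_mul {g : E → ℝ} (hg : Differentiable ℝ g) (c : ℝ) (u v : E) :
    breg (fun y => c * g y) u v = c * breg g u v := by
  simp only [breg_eq_fderiv, fderiv_const_mul (hg u), smul_apply, smul_eq_mul]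
  ring

theorem breg_affine (c : ℝ) (g x u v : E) : breg (fun y => c + ⟪g, y - x⟫_ℝ) u v = 0 := by
  have hd : Differentiable ℝ fun y => c + ⟪g, y - x⟫_ℝ :=
    ((differentiable_const g).inner ℝ (differentiable_id.sub_const x)).const_add c
  have h : HasDerivAt (fun s : ℝ => c + ⟪g, u + s • (v - u) - x⟫_ℝ) ⟪g, v - u⟫_ℝ 0 := by
    have h : HasDerivAt (fun s : ℝ => u + s • (v - u) - x) (v - u) 0 := by
      simpa using (((hasDerivAt_id (0 : ℝ)).smul_const (v - u)).const_add u).sub_const x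
    simpa using ((hasDerivAt_const (0 : ℝ) g).inner ℝ h).const_add c
  rw [breg_eq_of_hasDerivAt_line (hd u) h]
  simp only [inner_sub_right]
  ring

theorem breg_quadratic {A : E →L[ℝ] E →L[ℝ] ℝ} (hA : ∀ a b, A a b = A b a) (x u v : E) :
    breg (fun y => 1 / 2 * A (y - x) (y - x)) u v = 1 / 2 * A (v - u) (v - u) := by
  have hd : Differentiable ℝ fun y => 1 / 2 * A (y - x) (y - x) := by fun_prop
  have h : HasDerivAt (fun s : ℝ => 1 / 2 * A (u + s • (v - u) - x) (u + s • (v - u) - x))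
      (A (u - x) (v - u)) 0 := by
    have h : HasDerivAt (fun s : ℝ => u + s • (v - u) - x) (v - u) 0 := by
      simpa using (((hasDerivAt_id (0 : ℝ)).smul_const (v - u)).const_add u).sub_const x
    have := (((A.hasFDerivAt.comp_hasDerivAt 0 h).clm_apply h)).const_mul (1 / 2)
    simp only [zero_smul, add_zero, Function.comp_def] at this
    convert! this using 1
    rw [hA (v - u) (u - x)]
    ring
  rw [breg_eq_of_hasDerivAt_line (hd u) h]
  have hv : v - x = (u - x) + (v - u) := by abel
  rw [hv]
  simp only [map_add, add_apply]
  rw [hA (v - u) (u - x)]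
  ring

theorem breg_cubic {C : E →L[ℝ] E →L[ℝ] E →L[ℝ] ℝ} (hC : ∀ a b c, C a b c = C b a c)
    (hC' : ∀ a b c, C a b c = C a c b) (x u v : E) :
    breg (fun y => 1 / 6 * C (y - x) (y - x) (y - x)) u v =
      1 / 2 * C (u - x) (v - u) (v - u) + 1 / 6 * C (v - u) (v - u) (v - u) := by
  have hd : Differentiable ℝ fun y => 1 / 6 * C (y - x) (y - x) (y - x) := by fun_prop
  have e₁ : C (v - u) (u - x) (u - x) = C (u - x) (u - x) (v - u) := by
    rw [hC, hC']
  have e₂ : C (u - x) (v - u) (u - x) = C (u - x) (u - x) (v - u) := hC' _ _ _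
  have e₃ : C (v - u) (v - u) (u - x) = C (u - x) (v - u) (v - u) := by
    rw [hC', hC]
  have e₄ : C (v - u) (u - x) (v - u) = C (u - x) (v - u) (v - u) := hC _ _ _
  have h : HasDerivAt (fun s : ℝ =>
      1 / 6 * C (u + s • (v - u) - x) (u + s • (v - u) - x) (u + s • (v - u) - x))
      (1 / 2 * C (u - x) (u - x) (v - u)) 0 := by
    have hexp : (fun s : ℝ =>
        1 / 6 * C (u + s • (v - u) - x) (u + s • (v - u) - x) (u + s • (v - u) - x)) = fun s : ℝ =>
        1 / 6 * C (u - x) (u - x) (u - x) + 1 / 2 * C (u - x) (u - x) (v - u) * s +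
        1 / 2 * C (u - x) (v - u) (v - u) * s ^ 2 + 1 / 6 * C (v - u) (v - u) (v - u) * s ^ 3 := by
      ext s
      rw [show u + s • (v - u) - x = (u - x) + s • (v - u) by abel]
      generalize u - x = a at *
      generalize v - u = b at *
      simp only [map_add, map_smul, add_apply, smul_apply, smul_eq_mul, e₁, e₂, e₃, e₄]
      ring
    rw [hexp]
    have := ((((hasDerivAt_id (0 : ℝ)).const_mul (1 / 2 * C (u - x) (u - x) (v - u))).const_add
      (1 / 6 * C (u - x) (u - x) (u - x))).add
      ((hasDerivAt_pow 2 (0 : ℝ)).const_mul (1 / 2 * C (u - x) (v - u) (v - u)))).add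
      ((hasDerivAt_pow 3 (0 : ℝ)).const_mul (1 / 6 * C (v - u) (v - u) (v - u)))
    convert! this using 1
    simp
  rw [breg_eq_of_hasDerivAt_line (hd u) h]
  have hv : v - x = (u - x) + (v - u) := by abel
  rw [hv]
  simp only [map_add, add_apply, e₁, e₂, e₃, e₄]
  ring

/-- Second-order criterion for the Bregman distance of the power of the norm. -/
theorem nonneg_add_mul_breg_norm_rpow {ν : ℝ} (hν : 0 ≤ ν) (x u v : E) {F F' F'' : ℝ → ℝ} {c : ℝ}
    (h₁ : ∀ t, HasDerivAt F (F' t) t) (h₂ : ∀ t, HasDerivAt F' (F'' t) t)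
    (h : ∀ t ∈ Set.Icc (0 : ℝ) 1, 0 ≤ F'' t +
      c * (‖u - x + t • (v - u)‖ ^ (1 + ν) * ‖v - u‖ ^ 2 + (1 + ν) *
        ‖u - x + t • (v - u)‖ ^ (1 + ν - 2) * ⟪u - x + t • (v - u), v - u⟫_ℝ ^ 2)) :
    0 ≤ F 1 - F 0 - F' 0 +
      c * breg (fun y : E => 1 / (3 + ν) * ‖y - x‖ ^ ((3 : ℝ) + ν)) u v := by
  have hd := fun t => hasDerivAt_norm_rpow_line (p := 3 + ν) (by linarith) (u - x) (v - u) t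
  have hd2 := fun t => hasDerivAt_norm_rpow_line_second (q := 1 + ν) (by linarith)
    (u - x) (v - u) t
  simp only [show 3 + ν - 2 = 1 + ν by ring] at hd
  have hfun : (fun s : ℝ => 1 / (3 + ν) * ‖u + s • (v - u) - x‖ ^ ((3 : ℝ) + ν)) =
      fun s : ℝ => ‖u - x + s • (v - u)‖ ^ (3 + ν) / (3 + ν) := by
    ext s
    rw [show u + s • (v - u) - x = u - x + s • (v - u) by abel]
    ring
  rw [breg_eq_of_hasDerivAt_line (differentiable_norm_sub_rpow hν x u) (hfun ▸ hd 0)]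
  have := le_of_hasDerivAt_of_second_nonneg
    (fun t => (h₁ t).add ((hd t).const_mul c)) (fun t => (h₂ t).add ((hd2 t).const_mul c)) h
  simp only [Pi.add_apply, zero_smul, add_zero, one_smul, sub_add_sub_cancel'] at this
  simp only [zero_smul, add_zero]
  linear_combination this

theorem breg_norm_rpow_nonneg {ν : ℝ} (hν : 0 ≤ ν) (x u v : E) :
    0 ≤ breg (fun y : E => 1 / (3 + ν) * ‖y - x‖ ^ ((3 : ℝ) + ν)) u v := by
  have := nonneg_add_mul_breg_norm_rpow hν x u v (F := 0) (F' := fun _ => 0) (F'' := fun _ => 0)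
    (c := 1) (fun t => hasDerivAt_const t _) (fun t => hasDerivAt_const t _)
    (fun t _ => by positivity)
  simpa using this

theorem breg_norm_rpow_le {ν R : ℝ} (hν : 0 ≤ ν) {x u v : E}
    (hR : ∀ t ∈ Set.Icc (0 : ℝ) 1, ‖u - x + t • (v - u)‖ ≤ R) :
    breg (fun y : E => 1 / (3 + ν) * ‖y - x‖ ^ ((3 : ℝ) + ν)) u v ≤
      (2 + ν) * R ^ (1 + ν) / 2 * ‖v - u‖ ^ 2 := by
  set K := (2 + ν) * R ^ (1 + ν) * ‖v - u‖ ^ 2 with hK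
  have h₁ : ∀ t : ℝ, HasDerivAt (fun s => K / 2 * s ^ 2) (K * t) t := fun t => by
    convert! (hasDerivAt_pow 2 t).const_mul (K / 2) using 1
    push_cast
    ring
  have h₂ : ∀ t : ℝ, HasDerivAt (fun s => K * s) K t := fun t => by
    simpa using (hasDerivAt_id t).const_mul K
  have := nonneg_add_mul_breg_norm_rpow hν x u v h₁ h₂ (c := -1) fun t ht => by
    have h := rpow_second_le hν (u - x + t • (v - u)) (v - u)
    have : (2 + ν) * ‖u - x + t • (v - u)‖ ^ (1 + ν) * ‖v - u‖ ^ 2 ≤ K := by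
      rw [hK]
      gcongr
      exact hR t ht
    linarith
  linear_combination this

/-- The scaled third-order Taylor polynomial of a convex function, regularized by a power of the
norm, is convex. -/
theorem breg_taylor_nonneg {f : E → ℝ} (hf : ContDiff ℝ 3 f) (hconv : ConvexOn ℝ Set.univ f)
    {ν Hf : ℝ} (hν : 0 ≤ ν) (hHf : 0 ≤ Hf)
    (hHolder : ∀ x y : E,
      ‖iteratedFDeriv ℝ 3 f x - iteratedFDeriv ℝ 3 f y‖ ≤ Hf * ‖x - y‖ ^ ν) (s : ℝ) (x u v : E) :
    0 ≤ 1 / 2 * fderiv ℝ (fderiv ℝ f) x (v - u) (v - u) +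
      s * (1 / 2 * fderiv ℝ (fderiv ℝ (fderiv ℝ f)) x (u - x) (v - u) (v - u) +
        1 / 6 * fderiv ℝ (fderiv ℝ (fderiv ℝ f)) x (v - u) (v - u) (v - u)) +
      |s| ^ (1 + ν) * Hf * breg (fun y : E => 1 / (3 + ν) * ‖y - x‖ ^ ((3 : ℝ) + ν)) u v := by
  set w := v - u with hw
  set a := fderiv ℝ (fderiv ℝ f) x w w
  set b := fderiv ℝ (fderiv ℝ (fderiv ℝ f)) x (u - x) w w with hb
  set c := fderiv ℝ (fderiv ℝ (fderiv ℝ f)) x w w w with hc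
  have h₁ : ∀ t : ℝ, HasDerivAt (fun r => (a + s * b) / 2 * r ^ 2 + s * c / 6 * r ^ 3)
      ((a + s * b) * t + s * c / 2 * t ^ 2) t := fun t => by
    convert! ((hasDerivAt_pow 2 t).const_mul ((a + s * b) / 2)).add
      ((hasDerivAt_pow 3 t).const_mul (s * c / 6)) using 1
    push_cast
    ring
  have h₂ : ∀ t : ℝ, HasDerivAt (fun r => (a + s * b) * r + s * c / 2 * r ^ 2)
      ((a + s * b) + s * c * t) t := fun t => by
    convert! ((hasDerivAt_id t).const_mul (a + s * b)).add
      ((hasDerivAt_pow 2 t).const_mul (s * c / 2)) using 1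
    push_cast
    ring
  have := nonneg_add_mul_breg_norm_rpow hν x u v h₁ h₂ (c := |s| ^ (1 + ν) * Hf) fun t _ => by
    have h0 := hconv.fderiv_fderiv_nonneg hf (x + s • (u - x + t • w)) w
    have hle := fderiv_fderiv_le_of_holder hf hν hHf hHolder x (s • (u - x + t • w)) w
    have hs := le_rpow_second hν (u - x + t • w) w
    have hs' := mul_le_mul_of_nonneg_left hs (by positivity : 0 ≤ |s| ^ (1 + ν) * Hf)
    rw [norm_smul, Real.norm_eq_abs, Real.mul_rpow (abs_nonneg _) (norm_nonneg _)] at hle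
    simp only [map_add, map_smul, add_apply, smul_apply, smul_eq_mul, ← hb, ← hc] at hle
    rw [← hw]
    linarith
  linear_combination this

/-- Upper bound of a function by its third-order Taylor polynomial plus a power of the norm. -/
theorem le_taylor_add_norm_rpow {f : E → ℝ} (hf : ContDiff ℝ 3 f)
    {ν Hf : ℝ} (hν : 0 ≤ ν) (hHf : 0 ≤ Hf)
    (hHolder : ∀ x y : E,
      ‖iteratedFDeriv ℝ 3 f x - iteratedFDeriv ℝ 3 f y‖ ≤ Hf * ‖x - y‖ ^ ν) (x v : E) :
    f v ≤ f x + fderiv ℝ f x (v - x) + 1 / 2 * fderiv ℝ (fderiv ℝ f) x (v - x) (v - x) +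
      1 / 6 * fderiv ℝ (fderiv ℝ (fderiv ℝ f)) x (v - x) (v - x) (v - x) +
      Hf * (1 / (3 + ν) * ‖v - x‖ ^ ((3 : ℝ) + ν)) := by
  set w := v - x with hw
  set a := fderiv ℝ (fderiv ℝ f) x w w
  set c := fderiv ℝ (fderiv ℝ (fderiv ℝ f)) x w w w with hc
  have hd : Differentiable ℝ f := hf.differentiable (by norm_num)
  have h₁ : ∀ t : ℝ, HasDerivAt (fun r => a / 2 * r ^ 2 + c / 6 * r ^ 3 - f (x + r • w))
      (a * t + c / 2 * t ^ 2 - fderiv ℝ f (x + t • w) w) t := fun t => by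
    convert! (((hasDerivAt_pow 2 t).const_mul (a / 2)).add
      ((hasDerivAt_pow 3 t).const_mul (c / 6))).sub (hasDerivAt_comp_line hd x w t) using 1
    push_cast
    ring
  have h₂ : ∀ t : ℝ, HasDerivAt (fun r => a * r + c / 2 * r ^ 2 - fderiv ℝ f (x + r • w) w)
      (a + c * t - fderiv ℝ (fderiv ℝ f) (x + t • w) w w) t := fun t => by
    convert! (((hasDerivAt_id t).const_mul a).add
      ((hasDerivAt_pow 2 t).const_mul (c / 2))).sub (hasDerivAt_fderiv_line hf x w w t) using 1
    push_cast
    ring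
  have := nonneg_add_mul_breg_norm_rpow hν x x v h₁ h₂ (c := Hf) fun t _ => by
    have hle := fderiv_fderiv_le_of_holder hf hν hHf hHolder x (t • w) w
    have hs := mul_le_mul_of_nonneg_left (le_rpow_second hν (x - x + t • w) w) hHf
    simp only [map_smul, smul_apply, smul_eq_mul, ← hc] at hle
    rw [← hw]
    rw [sub_self, zero_add] at hs ⊢
    linarith
  have hbr : breg (fun y : E => 1 / (3 + ν) * ‖y - x‖ ^ ((3 : ℝ) + ν)) x v =
      1 / (3 + ν) * ‖w‖ ^ ((3 : ℝ) + ν) := by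
    have hp : (3 : ℝ) + ν ≠ 0 := by positivity
    have := hasDerivAt_norm_rpow_line (p := 3 + ν) (by linarith) (0 : E) (v - x) 0
    rw [breg_eq_of_hasDerivAt_line (d := 0) (differentiable_norm_sub_rpow hν x x)]
    · simp [hp, hw]
    · simpa [div_eq_inv_mul] using this
  rw [hbr] at this
  have hv : x + w = v := by rw [hw]; abel
  simp only [one_smul, zero_smul, add_zero, hv] at this
  linear_combination this

end

section
variable {E : Type*} [NormedAddCommGroup E] [InnerProductSpace ℝ E] [CompleteSpace E]

theorem stepOK.three_point {g d : E → ℝ} (hd : Differentiable ℝ d) {M : ℝ} {u w : E}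
    (h : stepOK g d M u w) (z : E) :
    ⟪gradient g u, z - u⟫_ℝ + M * breg d u z =
      ⟪gradient g u, w - u⟫_ℝ + M * breg d u w + M * breg d w z := by
  have hmin : IsLocalMin (fun z => ⟪gradient g u, z - u⟫_ℝ + M * breg d u z) w :=
    Filter.Eventually.of_forall h.1
  have hder : HasFDerivAt (fun z => ⟪gradient g u, z - u⟫_ℝ + M * breg d u z)
      (innerSL ℝ (gradient g u) + M • (fderiv ℝ d w - innerSL ℝ (gradient d u))) w := by
    have hl : ∀ a : E, HasFDerivAt (fun z => ⟪a, z - u⟫_ℝ) (innerSL ℝ a) w := fun a => by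
      convert! (innerSL ℝ a).hasFDerivAt.comp w ((hasFDerivAt_id w).sub_const u) using 1
    exact (hl _).add ((((hd w).hasFDerivAt.sub_const (d u)).sub (hl (gradient d u))).const_mul M)
  have h0 := congrArg (fun l => l (z - w)) (hmin.hasFDerivAt_eq_zero hder)
  simp only [add_apply, smul_apply, sub_apply, innerSL_apply_apply, smul_eq_mul,
    zero_apply] at h0
  have hs : ∀ a : E, ⟪a, z - u⟫_ℝ = ⟪a, z - w⟫_ℝ + ⟪a, w - u⟫_ℝ := fun a => by
    rw [← inner_add_right, sub_add_sub_cancel]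
  rw [breg_eq_fderiv d w z, breg, breg, hs (gradient g u), hs (gradient d u)]
  linear_combination h0

theorem stepOK.descent {g d : E → ℝ} (hd : Differentiable ℝ d) {μ M : ℝ} {u w : E}
    (hμ : ∀ u v, μ * breg d u v ≤ breg g u v) (h : stepOK g d M u w) (z : E) :
    g w ≤ g z + (M - μ) * breg d u z - M * breg d w z := by
  have h₁ := h.three_point hd z
  have h₂ := h.2
  have h₃ := hμ u z
  have h₄ : breg g u z = g z - g u - ⟪gradient g u, z - u⟫_ℝ := rfl
  linarith

/-- Linear convergence of Bregman proximal gradient steps under relative strong convexity. -/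
theorem breg_gradient_rate {g d : E → ℝ} (hd : Differentiable ℝ d)
    (hd0 : ∀ u v, 0 ≤ breg d u v) {μ B : ℝ} (hμ0 : 0 < μ) (hμB : μ ≤ B)
    (hμ : ∀ u v, μ * breg d u v ≤ breg g u v) {S : E} (hS : ∀ z, g S ≤ g z)
    {y : ℕ → E} {M : ℕ → ℝ} (hM0 : ∀ k, 0 < M k) (hMB : ∀ k, M k ≤ B)
    (hstep : ∀ k, stepOK g d (M k) (y k) (y (k + 1))) :
    (∀ n, g (y n) ≤ g (y 0)) ∧ ∀ n, (g (y n) - g S) * (1 - (1 - μ / B) ^ n) ≤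
      μ * (1 - μ / B) ^ n * breg d (y 0) S := by
  have hB : 0 < B := hμ0.trans_le hμB
  have hmono : ∀ n, g (y (n + 1)) ≤ g (y n) := fun n => by
    have h := (hstep n).descent hd hμ (y n)
    have h0 : breg d (y n) (y n) = 0 := by simp [breg]
    have := mul_nonneg (hM0 n).le (hd0 (y (n + 1)) (y n))
    rw [h0] at h
    linarith
  refine ⟨fun n => antitone_nat_of_succ_le (f := fun n => g (y n)) hmono (Nat.zero_le n), ?_⟩
  set q := 1 - μ / B with hq
  have hq0 : 0 ≤ q := sub_nonneg.mpr ((div_le_one hB).mpr hμB)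
  have hqB : B * q = B - μ := by rw [hq]; field_simp
  have key : ∀ n, μ * breg d (y n) S + (g (y n) - g S) * (1 - q ^ n) ≤
      μ * q ^ n * breg d (y 0) S := by
    intro n
    induction n with
    | zero => simp
    | succ n ih =>
      set β := breg d (y n) S
      set β' := breg d (y (n + 1)) S
      have h₁ := (hstep n).descent hd hμ S
      have hS' := hS (y (n + 1))
      have hβ : β' ≤ β := by
        have : M n * β' ≤ M n * β := by
          have := mul_nonneg hμ0.le (hd0 (y n) S)
          linarith
        exact le_of_mul_le_mul_left this (hM0 n)
      have h₂ : g (y (n + 1)) - g S ≤ B * (q * β - β') := by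
        have := mul_le_mul_of_nonneg_right (hMB n) (sub_nonneg.mpr hβ)
        linear_combination h₁ + this - β * hqB
      have h₃ : (1 - q) * (g (y (n + 1)) - g S) ≤ μ * (q * β - β') := by
        have e : B * (1 - q) = μ := by linear_combination -hqB
        have h1q : 0 ≤ 1 - q := by rw [hq]; simp only [sub_sub_cancel]; positivity
        have := mul_le_mul_of_nonneg_left h₂ h1q
        linear_combination this + (q * β - β') * e
      have h₄ : q * (1 - q ^ n) * (g (y (n + 1)) - g S) ≤ q * (1 - q ^ n) * (g (y n) - g S) := by
        have hqn : q ^ n ≤ 1 := pow_le_one₀ hq0 (by rw [hq]; linarith [div_pos hμ0 hB])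
        exact mul_le_mul_of_nonneg_left (by linarith [hmono n])
          (mul_nonneg hq0 (sub_nonneg.mpr hqn))
      have h₅ := mul_le_mul_of_nonneg_left ih hq0
      rw [pow_succ]
      linear_combination h₃ + h₄ + h₅
  intro n
  have := mul_nonneg hμ0.le (hd0 (y n) S)
  linarith [key n]

/-- The accepted coefficients of the adaptive method are bounded as soon as every coefficient above
a threshold `D` is acceptable. -/
theorem algA.coeff_bounds {g d : E → ℝ} {L₀ D : ℝ} {y : ℕ → E} {L : ℕ → ℝ} {i : ℕ → ℕ}
    (hL₀ : 0 < L₀) (hD : 0 < D) (hacc : ∀ M, D ≤ M → ∀ u, ∃ w, stepOK g d M u w)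
    (h : algA g d L₀ y L i) (k : ℕ) :
    0 < 2 ^ i k * L k ∧ 2 ^ i k * L k ≤ max (2 * L₀) (4 * D) := by
  have hcoef : ∀ k, 2 ^ i k * L k ≤ max (2 * D) (L k) := fun k => by
    rcases Nat.eq_zero_or_eq_succ_pred (i k) with h0 | hs
    · rw [h0]
      simp
    · have hlt : 2 ^ (i k).pred * L k < D := by
        by_contra! hle
        exact (h.2 k).2.1 (i k).pred (by omega) (hacc _ hle (y k))
      apply le_max_of_le_left
      rw [hs, pow_succ]
      linarith
  have hL : ∀ k, 0 < L k ∧ L k ≤ max L₀ D := by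
    intro k
    induction k with
    | zero => simp [h.1, hL₀]
    | succ k ih =>
      have hc := hcoef k
      rw [(h.2 k).2.2]
      refine ⟨by have := ih.1; positivity, ?_⟩
      rcases le_max_iff.mp hc with hc | hc
      · exact le_max_of_le_right (by linarith)
      · linarith [ih.1, ih.2]
  refine ⟨by have := (hL k).1; positivity, (hcoef k).trans (max_le ?_ ((hL k).2.trans ?_))⟩
  · exact le_max_of_le_right (by linarith)
  · exact max_le_max (by linarith) (by linarith)

/-- A gradient bound at a point with small optimality gap. -/
theorem sq_le_of_lt_norm_gradient {g : E → ℝ} {y S : E} {D ε : ℝ} (hε : 0 < ε) (hεD : ε ≤ D)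
    (hS : ∀ z, g S ≤ g z) (hD : ∀ z, ‖z - y‖ ≤ 1 → breg g y z ≤ D / 2 * ‖z - y‖ ^ 2)
    (hg : ε < ‖gradient g y‖) : ε ^ 2 ≤ 2 * D * (g y - g S) := by
  set v := gradient g y with hv
  have hv0 : 0 < ‖v‖ := hε.trans hg
  have hD0 : 0 < D := hε.trans_le hεD
  set t := ε / D with ht
  have htD : t * D = ε := div_mul_cancel₀ _ hD0.ne'
  have ht0 : 0 < t := by positivity
  set z := y - (t / ‖v‖) • v with hz
  have hzy : z - y = -((t / ‖v‖) • v) := by rw [hz]; abel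
  have hn : ‖z - y‖ = t := by
    rw [hzy, norm_neg, norm_smul, Real.norm_of_nonneg (by positivity),
      div_mul_cancel₀ _ hv0.ne']
  have hi : ⟪v, z - y⟫_ℝ = -(t * ‖v‖) := by
    rw [hzy, inner_neg_right, real_inner_smul_right, real_inner_self_eq_norm_sq]
    field_simp
  have h := hD z (hn ▸ (div_le_one hD0).mpr hεD)
  rw [breg, ← hv, hi, hn] at h
  have h₁ := hS z
  have h₂ : t * ε ≤ t * ‖v‖ := by gcongr
  have h₃ : t * ε - D / 2 * t ^ 2 ≤ g y - g S := by linarith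
  have h₄ := mul_le_mul_of_nonneg_left h₃ (by positivity : 0 ≤ 2 * D)
  have e : 2 * D * (t * ε - D / 2 * t ^ 2) = ε ^ 2 := by rw [← htD]; ring
  linarith

end

theorem exists_forall_le_of_quadratic_growth {E : Type*} [NormedAddCommGroup E]
    [InnerProductSpace ℝ E] [FiniteDimensional ℝ E] {J : E → ℝ} (hJ : Continuous J) {c a b : ℝ}
    (hc : 0 < c) (x : E) (h : ∀ z, c * ‖z - x‖ ^ 2 - a * ‖z - x‖ - b ≤ J z) :
    ∃ w, ∀ z, J w ≤ J z := by
  refine hJ.exists_forall_le' x ?_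
  set R := max ((a + 1) / c) (max (J x + b) 0) with hR
  filter_upwards [(tendsto_norm_cocompact_atTop (E := E)).eventually_ge_atTop (R + ‖x‖)] with z hz
  have hr : R ≤ ‖z - x‖ := by linarith [norm_sub_norm_le z x]
  have h₁ : (a + 1) / c ≤ ‖z - x‖ := (le_max_left _ _).trans hr
  have h₂ : J x + b ≤ ‖z - x‖ := (le_max_left _ _).trans ((le_max_right _ _).trans hr)
  rw [div_le_iff₀ hc] at h₁
  have := mul_le_mul_of_nonneg_right h₁ (norm_nonneg (z - x))
  linarith [h z]

section
variable {E : Type*} [NormedAddCommGroup E] [InnerProductSpace ℝ E]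

theorem sub_one_le_rpow {r p : ℝ} (hr : 0 ≤ r) (hp : 2 ≤ p) : r ^ 2 - 1 ≤ r ^ p := by
  rcases le_total r 1 with h | h
  · have : r ^ 2 ≤ 1 := pow_le_one₀ hr h
    linarith [Real.rpow_nonneg hr p]
  · have : r ^ (2 : ℝ) ≤ r ^ p := Real.rpow_le_rpow_of_exponent_le h hp
    rw [Real.rpow_two] at this
    linarith

variable [FiniteDimensional ℝ E]

/-- The relatively regularized step exists as soon as its coefficient dominates the relative
smoothness constant. -/
theorem exists_stepOK {g d : E → ℝ} (hd : Differentiable ℝ d) {L M p c : ℝ}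
    (hd0 : ∀ u v, 0 ≤ breg d u v) (hL : ∀ u v, breg g u v ≤ L * breg d u v) (hLM : L ≤ M)
    (hM : 0 < M) (hc : 0 < c) (hp : 2 ≤ p) (x : E) (hgrow : ∀ z, c * ‖z - x‖ ^ p ≤ d z) (u : E) :
    ∃ w, stepOK g d M u w := by
  set G := gradient g u - M • gradient d u with hG
  have hexp : ∀ z, ⟪gradient g u, z - u⟫_ℝ + M * breg d u z =
      ⟪G, z - u⟫_ℝ + M * (d z - d u) := fun z => by
    rw [hG, inner_sub_left, real_inner_smul_left, breg]
    ring
  obtain ⟨w, hw⟩ := exists_forall_le_of_quadratic_growth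
    (J := fun z => ⟪G, z - u⟫_ℝ + M * (d z - d u)) (c := M * c) (a := ‖G‖)
    (b := ‖G‖ * ‖x - u‖ + M * c + M * d u)
    ((continuous_const.inner (continuous_id.sub continuous_const)).add
      (continuous_const.mul (hd.continuous.sub continuous_const))) (by positivity) x fun z => by
    have h₁ : -(‖G‖ * ‖z - u‖) ≤ ⟪G, z - u⟫_ℝ :=
      (abs_le.mp (abs_real_inner_le_norm G (z - u))).1
    have h₂ : ‖G‖ * ‖z - u‖ ≤ ‖G‖ * (‖z - x‖ + ‖x - u‖) := by
      gcongr
      exact norm_sub_le_norm_sub_add_norm_sub z x u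
    have h₃ := mul_le_mul_of_nonneg_left (sub_one_le_rpow (norm_nonneg (z - x)) hp) hc.le
    have h₄ := mul_le_mul_of_nonneg_left (h₃.trans (hgrow z)) hM.le
    linarith
  refine ⟨w, fun z => by rw [hexp, hexp]; exact hw z, ?_⟩
  have h₁ := (hL u w).trans (mul_le_mul_of_nonneg_right hLM (hd0 u w))
  have h₂ : breg g u w = g w - g u - ⟪gradient g u, w - u⟫_ℝ := rfl
  linarith

end

/-- Relative smoothness and strong convexity constants obtained by balancing the cubic term. -/
theorem relative_bounds {Q P c τ ν h : ℝ} (hτ : 1 < τ) (hP : 0 ≤ P) (hQ : 0 ≤ Q)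
    (h₁ : 0 ≤ Q + τ * c + τ ^ (1 + ν) * h * P) (h₂ : 0 ≤ Q + -τ * c + τ ^ (1 + ν) * h * P) :
    min ((τ - 1) / τ) (τ ^ ν * (τ - 1) * h) * (Q + P) ≤ Q + c + τ ^ (1 + ν) * h * P ∧
      Q + c + τ ^ (1 + ν) * h * P ≤ max ((τ + 1) / τ) (τ ^ ν * (τ + 1) * h) * (Q + P) := by
  have hτ0 : 0 < τ := by linarith
  have hp : τ ^ (1 + ν) = τ * τ ^ ν := by rw [Real.rpow_add hτ0, Real.rpow_one]
  rw [hp] at h₁ h₂ ⊢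
  have h₁' : 0 ≤ Q / τ + c + τ ^ ν * h * P := by
    have := div_nonneg h₁ hτ0.le
    rwa [show (Q + τ * c + τ * τ ^ ν * h * P) / τ = Q / τ + c + τ ^ ν * h * P by
      field_simp] at this
  have h₂' : 0 ≤ Q / τ - c + τ ^ ν * h * P := by
    have := div_nonneg h₂ hτ0.le
    rwa [show (Q + -τ * c + τ * τ ^ ν * h * P) / τ = Q / τ - c + τ ^ ν * h * P by
      field_simp; ring] at this
  have e₁ : (τ - 1) / τ * Q = Q - Q / τ := by field_simp
  have e₂ : (τ + 1) / τ * Q = Q + Q / τ := by field_simp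
  constructor
  · have l₁ := mul_le_mul_of_nonneg_right (min_le_left ((τ - 1) / τ) (τ ^ ν * (τ - 1) * h)) hQ
    have l₂ := mul_le_mul_of_nonneg_right (min_le_right ((τ - 1) / τ) (τ ^ ν * (τ - 1) * h)) hP
    linarith
  · have l₁ := mul_le_mul_of_nonneg_right (le_max_left ((τ + 1) / τ) (τ ^ ν * (τ + 1) * h)) hQ
    have l₂ := mul_le_mul_of_nonneg_right (le_max_right ((τ + 1) / τ) (τ ^ ν * (τ + 1) * h)) hP
    linarith

/-- From a geometric gap estimate to the logarithmic complexity bound. -/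
theorem mul_logb_le_of_sq_le {ν μ B N ε : ℝ} {T : ℕ} (hν : ν ∈ Set.Icc (0 : ℝ) 1) (hμ : 0 < μ)
    (hμB : μ < B) (hB : 1 ≤ B) (hN : 1 ≤ N) (hε : ε ∈ Set.Ioo (0 : ℝ) 1)
    (h : ε ^ 2 ≤ B * N ^ 3 * μ * (1 - μ / B) ^ T) :
    (T : ℝ) * Real.logb 2 (B / (B - μ)) ≤
      Real.logb 2 ((2 : ℝ) ^ ((3 : ℝ) + ν) * (3 + ν) * B ^ ((2 : ℝ) + ν) * N ^ ((5 : ℝ) + ν) * μ) +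
        (3 + ν) * Real.logb 2 ε⁻¹ := by
  have hB0 : 0 < B := by linarith
  have hN0 : 0 < N := by linarith
  have hν0 := hν.1
  set q := 1 - μ / B with hq
  have hqB : B / (B - μ) = q⁻¹ := by
    have : B - μ ≠ 0 := by linarith
    rw [hq, one_sub_div hB0.ne', inv_div]
  have hq0 : 0 < q := sub_pos.mpr ((div_lt_one hB0).mpr hμB)
  set X := (2 : ℝ) ^ ((3 : ℝ) + ν) * (3 + ν) * B ^ ((2 : ℝ) + ν) * N ^ ((5 : ℝ) + ν) * μ with hX
  have hX0 : 0 < X := by have := Real.rpow_pos_of_pos hB0 (2 + ν); positivity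
  have h2 : (1 : ℝ) ≤ 2 ^ ((3 : ℝ) + ν) := Real.one_le_rpow (by norm_num) (by linarith)
  have h3 : B ≤ B ^ ((2 : ℝ) + ν) := Real.self_le_rpow_of_one_le hB (by linarith)
  have h4 : N ^ 3 ≤ N ^ ((5 : ℝ) + ν) := by
    rw [← Real.rpow_natCast]
    exact Real.rpow_le_rpow_of_exponent_le hN (by push_cast; linarith)
  have h5 : B * N ^ 3 * μ ≤ X := by
    have : 1 ≤ (2 : ℝ) ^ ((3 : ℝ) + ν) * (3 + ν) := one_le_mul_of_one_le_of_one_le h2 (by linarith)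
    calc B * N ^ 3 * μ = 1 * B * N ^ 3 * μ := by ring
      _ ≤ X := by rw [hX]; gcongr
  have h6 : ε ^ ((3 : ℝ) + ν) ≤ X * q ^ T := by
    calc ε ^ ((3 : ℝ) + ν) ≤ ε ^ (2 : ℝ) :=
          Real.rpow_le_rpow_of_exponent_ge hε.1 hε.2.le (by linarith)
      _ = ε ^ 2 := Real.rpow_two ε
      _ ≤ B * N ^ 3 * μ * q ^ T := h
      _ ≤ X * q ^ T := by gcongr
  have h7 := Real.logb_le_logb_of_le (b := 2) (by norm_num) (Real.rpow_pos_of_pos hε.1 _) h6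
  rw [Real.logb_mul hX0.ne' (pow_pos hq0 _).ne', Real.logb_pow,
    Real.logb_rpow_eq_mul_logb_of_pos hε.1] at h7
  rw [hqB, Real.logb_inv, Real.logb_inv]
  linarith

theorem pow_le_half_of_inv_logb_le {q : ℝ} (hq0 : 0 < q) (hq1 : q < 1) {n : ℕ}
    (h : (Real.logb 2 q⁻¹)⁻¹ ≤ n) : q ^ n ≤ 1 / 2 := by
  have hl : 0 < Real.logb 2 q⁻¹ := Real.logb_pos (by norm_num) ((one_lt_inv₀ hq0).mpr hq1)
  rw [inv_le_iff_one_le_mul₀ hl, Real.logb_inv, mul_neg, ← Real.logb_pow] at h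
  rw [← Real.logb_le_logb (b := 2) (by norm_num) (pow_pos hq0 n) (by norm_num), one_div,
    Real.logb_inv, Real.logb_self_eq_one (by norm_num)]
  linarith

section
variable {E : Type*} [NormedAddCommGroup E] [InnerProductSpace ℝ E] [CompleteSpace E]

/-- The Bregman distance of the regularized third-order Taylor model. -/
theorem breg_taylor_model {f : E → ℝ} (hf : ContDiff ℝ 3 f) {ν : ℝ} (hν : 0 ≤ ν) (c : ℝ)
    (x u v : E) :
    breg (fun y => f x + ⟪gradient f x, y - x⟫_ℝ
        + (1 / 2) * iteratedFDeriv ℝ 2 f x ![y - x, y - x]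
        + (1 / 6) * iteratedFDeriv ℝ 3 f x ![y - x, y - x, y - x]
        + c * ‖y - x‖ ^ ((3 : ℝ) + ν)) u v =
      1 / 2 * fderiv ℝ (fderiv ℝ f) x (v - u) (v - u) +
        (1 / 2 * fderiv ℝ (fderiv ℝ (fderiv ℝ f)) x (u - x) (v - u) (v - u) +
          1 / 6 * fderiv ℝ (fderiv ℝ (fderiv ℝ f)) x (v - u) (v - u) (v - u)) +
        c * (3 + ν) * breg (fun y : E => 1 / (3 + ν) * ‖y - x‖ ^ ((3 : ℝ) + ν)) u v := by
  have he : ∀ y, c * ‖y - x‖ ^ ((3 : ℝ) + ν) =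
      c * (3 + ν) * (1 / (3 + ν) * ‖y - x‖ ^ ((3 : ℝ) + ν)) := fun y => by
    have : 3 + ν ≠ 0 := by positivity
    field_simp
  simp only [iteratedFDeriv_two_apply, iteratedFDeriv_three_apply_eq hf, Matrix.cons_val_zero,
    Matrix.cons_val_one, he]
  set A := fderiv ℝ (fderiv ℝ f) x with hA
  set C := fderiv ℝ (fderiv ℝ (fderiv ℝ f)) x with hC
  have d₁ : Differentiable ℝ fun y => f x + ⟪gradient f x, y - x⟫_ℝ :=
    ((differentiable_const _).inner ℝ (differentiable_id.sub_const x)).const_add _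
  have d₂ : Differentiable ℝ fun y => 1 / 2 * A (y - x) (y - x) := by fun_prop
  have d₃ : Differentiable ℝ fun y => 1 / 6 * C (y - x) (y - x) (y - x) := by fun_prop
  have d₄ := differentiable_norm_sub_rpow hν x
  rw [breg_add ((d₁.fun_add d₂).fun_add d₃) (d₄.const_mul _), breg_add (d₁.fun_add d₂) d₃,
    breg_add d₁ d₂, breg_const_mul d₄, breg_affine, breg_quadratic (fderiv_fderiv_apply_comm hf x),
    breg_cubic (fderiv_three_apply_comm_left hf x) (fderiv_three_apply_comm_right hf x)]
  ring

theorem breg_reference {f : E → ℝ} (hf : ContDiff ℝ 3 f) {ν : ℝ} (hν : 0 ≤ ν) (x : E) :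
    Differentiable ℝ (fun y => (1 / 2) * iteratedFDeriv ℝ 2 f x ![y - x, y - x]
        + (1 / (3 + ν)) * ‖y - x‖ ^ ((3 : ℝ) + ν)) ∧ ∀ u v,
    breg (fun y => (1 / 2) * iteratedFDeriv ℝ 2 f x ![y - x, y - x]
        + (1 / (3 + ν)) * ‖y - x‖ ^ ((3 : ℝ) + ν)) u v =
      1 / 2 * fderiv ℝ (fderiv ℝ f) x (v - u) (v - u) +
        breg (fun y : E => 1 / (3 + ν) * ‖y - x‖ ^ ((3 : ℝ) + ν)) u v := by
  simp only [iteratedFDeriv_two_apply, Matrix.cons_val_zero, Matrix.cons_val_one]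
  set A := fderiv ℝ (fderiv ℝ f) x with hA
  have d₂ : Differentiable ℝ fun y => 1 / 2 * A (y - x) (y - x) := by fun_prop
  have d₄ := differentiable_norm_sub_rpow hν x
  exact ⟨d₂.fun_add d₄, fun u v => by
    rw [breg_add d₂ d₄, breg_quadratic (fderiv_fderiv_apply_comm hf x)]⟩

theorem breg_reference_le {f : E → ℝ} (hf : ContDiff ℝ 3 f) {ν R : ℝ}
    (hν : ν ∈ Set.Icc (0 : ℝ) 1) (hR1 : 1 ≤ R) {x u v : E}
    (hR : ∀ t ∈ Set.Icc (0 : ℝ) 1, ‖u - x + t • (v - u)‖ ≤ R) :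
    breg (fun y => (1 / 2) * iteratedFDeriv ℝ 2 f x ![y - x, y - x]
        + (1 / (3 + ν)) * ‖y - x‖ ^ ((3 : ℝ) + ν)) u v ≤
      (‖iteratedFDeriv ℝ 2 f x‖ + 3 * R ^ 2) / 2 * ‖v - u‖ ^ 2 := by
  rw [(breg_reference hf hν.1 x).2]
  have h₁ := breg_norm_rpow_le hν.1 hR
  have h₂ : R ^ (1 + ν) ≤ R ^ 2 := by
    rw [← Real.rpow_two]
    exact Real.rpow_le_rpow_of_exponent_le hR1 (by linarith [hν.2])
  have h₃ : (2 + ν) * R ^ (1 + ν) / 2 * ‖v - u‖ ^ 2 ≤ 3 * R ^ 2 / 2 * ‖v - u‖ ^ 2 := by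
    have := hν.1
    gcongr
    linarith [hν.2]
  have h₄ := (iteratedFDeriv ℝ 2 f x).le_opNorm ![v - u, v - u]
  have h₅ := (le_abs_self _).trans h₄
  rw [iteratedFDeriv_two_apply] at h₅
  simp only [Matrix.cons_val_zero, Matrix.cons_val_one, Fin.prod_univ_two] at h₅
  linarith

theorem le_taylor_model {f : E → ℝ} (hf : ContDiff ℝ 3 f) {ν Hf c : ℝ} (hν : 0 ≤ ν)
    (hHf : 0 ≤ Hf) (hc : Hf ≤ c * (3 + ν))
    (hHolder : ∀ x y : E,
      ‖iteratedFDeriv ℝ 3 f x - iteratedFDeriv ℝ 3 f y‖ ≤ Hf * ‖x - y‖ ^ ν) (x v : E) :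
    f v ≤ f x + ⟪gradient f x, v - x⟫_ℝ
        + (1 / 2) * iteratedFDeriv ℝ 2 f x ![v - x, v - x]
        + (1 / 6) * iteratedFDeriv ℝ 3 f x ![v - x, v - x, v - x]
        + c * ‖v - x‖ ^ ((3 : ℝ) + ν) := by
  have h₁ := le_taylor_add_norm_rpow hf hν hHf hHolder x v
  rw [iteratedFDeriv_two_apply, iteratedFDeriv_three_apply_eq hf, inner_gradient_left]
  simp only [Matrix.cons_val_zero, Matrix.cons_val_one]
  have h₂ : Hf * (1 / (3 + ν) * ‖v - x‖ ^ ((3 : ℝ) + ν)) ≤ c * ‖v - x‖ ^ ((3 : ℝ) + ν) := by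
    rw [← mul_assoc]
    gcongr
    rwa [mul_one_div, div_le_iff₀ (by positivity)]
  linarith

end

/-- Theorem 3.8. If `H > (6/(3+ν))·H_{f,3}(ν)` and Algorithm 1 (Algorithm A
applied to `Ω := Ω_{x,3,H}^{(ν)}` with reference function `ρ_x`, started at `y₀ = x`) has not
produced a point with `‖∇Ω(y_{T+1})‖ ≤ ε`, then
`T·log₂(M_H/(M_H − μ_H)) ≤ C_{x,H} + (3+ν)·log₂(ε⁻¹)` with
`C_{x,H} = log₂(2^{3+ν}(3+ν)M_H^{2+ν}N_x^{5+ν}μ_H)`. -/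
theorem statement_7
    {E : Type*} [NormedAddCommGroup E] [InnerProductSpace ℝ E] [FiniteDimensional ℝ E]
    (ν Hf : ℝ) (hν : ν ∈ Set.Icc (0 : ℝ) 1) (hHf : 0 < Hf)
    (f : E → ℝ) (hf : ContDiff ℝ 3 f) (hconv : ConvexOn ℝ Set.univ f)
    (hHolder : ∀ x y : E,
      ‖iteratedFDeriv ℝ 3 f x - iteratedFDeriv ℝ 3 f y‖ ≤ Hf * ‖x - y‖ ^ ν)
    (H : ℝ) (hH : 6 / (3 + ν) * Hf < H)
    (τH LH μH : ℝ)
    (hτH : τH = ((3 + ν) * H / (6 * Hf)) ^ (1 / (1 + ν)))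
    (hLH : LH = max ((τH + 1) / τH) (τH ^ ν * (τH + 1) * Hf))
    (hμH : μH = min ((τH - 1) / τH) (τH ^ ν * (τH - 1) * Hf))
    (x x0 xstar : E) (R0 : ℝ) (hR0 : 1 ≤ R0)
    (hmin : ∀ z : E, f xstar ≤ f z)
    (hxF : f x ≤ f x0)
    (hball : ∀ z : E, f z ≤ f x0 → ‖z - xstar‖ ≤ R0)
    (Ω ρ : E → ℝ)
    (hΩ : Ω = fun y => f x + ⟪gradient f x, y - x⟫_ℝ
        + (1 / 2) * iteratedFDeriv ℝ 2 f x ![y - x, y - x]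
        + (1 / 6) * iteratedFDeriv ℝ 3 f x ![y - x, y - x, y - x]
        + (H / 6) * ‖y - x‖ ^ ((3 : ℝ) + ν))
    (hρ : ρ = fun y => (1 / 2) * iteratedFDeriv ℝ 2 f x ![y - x, y - x]
        + (1 / (3 + ν)) * ‖y - x‖ ^ ((3 : ℝ) + ν))
    (hattain : ∃ S : E, ∀ z : E, Ω S ≤ Ω z)
    (L0 : ℝ) (hL0 : 0 < L0)
    (y : ℕ → E) (Lk : ℕ → ℝ) (ik : ℕ → ℕ)
    (hy0 : y 0 = x)
    (halg : algA Ω ρ L0 y Lk ik)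
    (MH Nx CxH : ℝ)
    (hMH : MH = max (2 * L0) (4 * LH))
    (hNx : Nx = ‖iteratedFDeriv ℝ 2 f x‖ + 12 * R0 ^ 2)
    (hCxH : CxH = Real.logb 2
      ((2 : ℝ) ^ ((3 : ℝ) + ν) * (3 + ν) * MH ^ ((2 : ℝ) + ν) * Nx ^ ((5 : ℝ) + ν) * μH))
    (ε : ℝ) (hε : ε ∈ Set.Ioo (0 : ℝ) 1)
    (T : ℕ)
    (hT : (Real.logb 2 (MH / (MH - μH)))⁻¹ ≤ (T : ℝ) + 1)
    (hgrad : ε < ‖gradient Ω (y (T + 1))‖) :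
    (T : ℝ) * Real.logb 2 (MH / (MH - μH)) ≤ CxH + (3 + ν) * Real.logb 2 ε⁻¹ := by
  have hν0 := hν.1
  have h3ν : (0 : ℝ) < 3 + ν := by linarith
  have hHH : Hf < H / 6 * (3 + ν) := by
    rw [div_mul_eq_mul_div, div_lt_iff₀ h3ν] at hH
    linarith
  have hbase : 1 < (3 + ν) * H / (6 * Hf) := by
    rw [one_lt_div (by positivity)]
    linarith
  have hτ : 1 < τH := hτH ▸ Real.one_lt_rpow hbase (by positivity)
  have hτ0 : 0 < τH := by linarith
  have hτp : H / 6 * (3 + ν) = τH ^ (1 + ν) * Hf := by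
    rw [hτH, ← Real.rpow_mul (by linarith), one_div_mul_cancel (by linarith), Real.rpow_one]
    field_simp
  have hμ0 : 0 < μH := by
    have := Real.rpow_pos_of_pos hτ0 ν
    rw [hμH]
    exact lt_min (div_pos (by linarith) hτ0) (mul_pos (mul_pos this (by linarith)) hHf)
  have hμ1 : μH < 1 := by
    rw [hμH]
    exact (min_le_left _ _).trans_lt ((div_lt_one hτ0).mpr (by linarith))
  have hL1 : 1 ≤ LH := by
    rw [hLH]
    exact ((one_le_div hτ0).mpr (by linarith)).trans (le_max_left _ _)
  have hMHL : 4 * LH ≤ MH := hMH ▸ le_max_right _ _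
  obtain ⟨hρd, hρb⟩ := breg_reference hf hν0 x
  have hΩb := breg_taylor_model hf hν0 (H / 6) x
  have hfΩ := le_taylor_model hf hν0 hHf.le hHH.le hHolder x
  have hρle := fun R (hR : 1 ≤ R) u v => breg_reference_le hf hν hR (x := x) (u := u) (v := v)
  rw [← hρ] at hρd hρb hρle
  rw [← hΩ] at hΩb
  have hfΩ' : ∀ v, f v ≤ Ω v := fun v => by rw [hΩ]; exact hfΩ v
  have hA := fun w => hconv.fderiv_fderiv_nonneg hf x w
  have hP := breg_norm_rpow_nonneg hν0 x
  have hrel : ∀ u v, μH * breg ρ u v ≤ breg Ω u v ∧ breg Ω u v ≤ LH * breg ρ u v := fun u v => by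
    have h₁ := breg_taylor_nonneg hf hconv hν0 hHf.le hHolder τH x u v
    have h₂ := breg_taylor_nonneg hf hconv hν0 hHf.le hHolder (-τH) x u v
    rw [abs_neg] at h₂
    rw [abs_of_pos hτ0] at h₁ h₂
    have := relative_bounds hτ (hP u v) (by linarith [hA (v - u)]) h₁ h₂
    rwa [← hμH, ← hLH, ← hτp, ← hρb, ← hΩb] at this
  have hρ0 : ∀ u v, 0 ≤ breg ρ u v := fun u v => by
    rw [hρb]
    linarith [hP u v, hA (v - u)]
  have hgrow : ∀ z, 1 / (3 + ν) * ‖z - x‖ ^ ((3 : ℝ) + ν) ≤ ρ z := fun z => by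
    simp only [hρ, iteratedFDeriv_two_apply, Matrix.cons_val_zero, Matrix.cons_val_one]
    linarith [hA (z - x)]
  have hM := halg.coeff_bounds hL0 (by linarith : 0 < LH) fun M hM u =>
    exists_stepOK hρd hρ0 (fun u v => (hrel u v).2) hM (by linarith) (by positivity)
      (by linarith) x hgrow u
  rw [← hMH] at hM
  obtain ⟨S, hS⟩ := hattain
  have hμM : μH < MH := by linarith
  obtain ⟨hmono, hrate⟩ := breg_gradient_rate hρd hρ0 hμ0 hμM.le (fun u v => (hrel u v).1) hS
    (fun k => (hM k).1) (fun k => (hM k).2) fun k => (halg.2 k).1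
  have hMpos : 0 < MH := by linarith
  rw [hy0] at hmono hrate
  have hΩx : Ω x = f x := by
    have : (3 : ℝ) + ν ≠ 0 := h3ν.ne'
    simp [hΩ, iteratedFDeriv_two_apply, iteratedFDeriv_three_apply_eq hf, this]
  have hdist : ∀ z, Ω z ≤ Ω x → ‖z - x‖ ≤ 2 * R0 := fun z hz => by
    have h₁ := hball z ((hfΩ' z).trans (hz.trans (hΩx.le.trans hxF)))
    have h₂ := hball x hxF
    rw [norm_sub_rev] at h₂
    linarith [norm_sub_le_norm_sub_add_norm_sub z xstar x]
  have hSx : breg ρ x S ≤ 2 * R0 ^ 2 * Nx := by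
    have hd := hdist S (hS x)
    have := hρle (2 * R0) (by linarith) x S fun t ht => by
      rw [sub_self, zero_add, norm_smul, Real.norm_of_nonneg ht.1]
      exact (mul_le_of_le_one_left (norm_nonneg _) ht.2).trans hd
    refine this.trans ?_
    rw [hNx]
    calc _ ≤ (‖iteratedFDeriv ℝ 2 f x‖ + 3 * (2 * R0) ^ 2) / 2 * (2 * R0) ^ 2 := by gcongr
      _ = _ := by ring
  set K := ‖iteratedFDeriv ℝ 2 f x‖ + 3 * (3 * R0) ^ 2 with hK
  have ha := norm_nonneg (iteratedFDeriv ℝ 2 f x)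
  have hR2 : 1 ≤ R0 ^ 2 := one_le_pow₀ hR0
  have hK1 : 1 ≤ K := by nlinarith
  have hgap := sq_le_of_lt_norm_gradient (D := LH * K) hε.1
    (hε.2.le.trans (one_le_mul_of_one_le_of_one_le hL1 hK1)) hS (fun z hz => by
      have hd := hdist _ (hmono (T + 1))
      have := hρle (3 * R0) (by linarith) (y (T + 1)) z fun t ht => by
        refine (norm_add_le _ _).trans ?_
        rw [norm_smul, Real.norm_of_nonneg ht.1]
        linarith [(mul_le_of_le_one_left (norm_nonneg (z - y (T + 1))) ht.2)]
      refine (hrel _ _).2.trans ((mul_le_mul_of_nonneg_left this (by linarith)).trans_eq ?_)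
      ring) hgrad
  set q := 1 - μH / MH with hq
  have hq1 : q < 1 := by linarith [div_pos hμ0 hMpos]
  have hq0 : 0 < q := sub_pos.mpr ((div_lt_one hMpos).mpr hμM)
  have hqinv : MH / (MH - μH) = q⁻¹ := by rw [hq, one_sub_div hMpos.ne', inv_div]
  have hhalf : q ^ (T + 1) ≤ 1 / 2 := by
    refine pow_le_half_of_inv_logb_le hq0 hq1 ?_
    rw [← hqinv]
    exact_mod_cast hT
  have hN1 : 1 ≤ Nx := by linarith
  have hG : Ω (y (T + 1)) - Ω S ≤ μH * q ^ T * (4 * R0 ^ 2 * Nx) := by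
    have h₁ := mul_le_mul_of_nonneg_left (sub_le_sub_left hhalf 1) (sub_nonneg.mpr (hS (y (T + 1))))
    have h₂ := hrate (T + 1)
    have h₃ : μH * q ^ (T + 1) * breg ρ x S ≤ μH * q ^ T * (2 * R0 ^ 2 * Nx) := by
      have : q ^ (T + 1) ≤ q ^ T := pow_le_pow_of_le_one hq0.le hq1.le (Nat.le_succ T)
      gcongr
      exact hρ0 x S
    linarith
  rw [hCxH]
  refine mul_logb_le_of_sq_le hν hμ0 hμM (by linarith) hN1 hε (hgap.trans ?_)
  have hK3 : K ≤ 3 * Nx := by rw [hK, hNx]; linarith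
  have hRN : 12 * R0 ^ 2 ≤ Nx := by linarith
  calc 2 * (LH * K) * (Ω (y (T + 1)) - Ω S)
      ≤ 2 * (MH / 4 * (3 * Nx)) * (μH * q ^ T * (4 * (Nx / 12) * Nx)) := by
        gcongr
        · exact sub_nonneg.mpr (hS _)
        · linarith
        · refine hG.trans ?_
          gcongr
          linarith
    _ = MH * Nx ^ 3 * μH * q ^ T / 2 := by ring
    _ ≤ MH * Nx ^ 3 * μH * q ^ T := half_le_self (by positivity)
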